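/- For G(n,p), E[∑_{i,j} |C_i|^2 |C_j|^2] ≤ (S_n(p) + 3·(S_n(p)/n)^4) · S_n(p), where the sum is over all ordered pairs of components (including i = j) and S_n(p) = E[∑_i |C_i|^2]. -/

import Mathlib

open scoped Classical BigOperators
noncomputable section

/-- Number of vertices in the connected component of `v` in `G`. -/
def compSize {V : Type*} (G : SimpleGraph V) (v : V) : ℕ :=
  Nat.card {w | G.Reachable v w}

/-- `∑_i |C_i|^k`, the sum of `k`-th powers of the component sizes of `G`. -/
def sumPow {V : Type*} [Fintype V] (G : SimpleGraph V) (k : ℕ) : ℝ :=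
  ∑ c : G.ConnectedComponent, (Nat.card c.supp : ℝ) ^ k

/-- Expectation, under bond percolation with parameter `p` on the finite graph `G`,
of a functional `f` of the resulting random subgraph. -/
def percExpect {V : Type*} [Fintype V] (G : SimpleGraph V) (p : ℝ)
    (f : SimpleGraph V → ℝ) : ℝ :=
  ∑ H ∈ Finset.univ.filter (fun H : SimpleGraph V => H ≤ G),
    p ^ (Nat.card H.edgeSet) * (1 - p) ^ (Nat.card G.edgeSet - Nat.card H.edgeSet) * f H

/-- `S_n(p) = E[∑_i |C_i|^2]` for the Erdős–Rényi random graph `G(n,p)`. -/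
def S (n : ℕ) (p : ℝ) : ℝ := percExpect (⊤ : SimpleGraph (Fin n)) p (fun H => sumPow H 2)

/-- Expectation of `f` at a random subset of `s` that keeps each element independently with
probability `p`. -/
def subsetExpect {α : Type*} (p : ℝ) (s : Finset α) (f : Finset α → ℝ) : ℝ :=
  ∑ F ∈ s.powerset, p ^ F.card * (1 - p) ^ (s.card - F.card) * f F

/-- Probability that a random subset of `s` satisfies `A`. -/
def subsetProb {α : Type*} (p : ℝ) (s : Finset α) (A : Finset α → Prop) : ℝ :=
  subsetExpect p s (fun F => if A F then 1 else 0)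

/-- Disjoint occurrence of two properties of finite sets. -/
def DisjOccur {α : Type*} [DecidableEq α] (A B : Finset α → Prop) (F : Finset α) : Prop :=
  ∃ K ⊆ F, A K ∧ B (F \ K)

section Subsets

variable {α : Type*} {p : ℝ}

lemma subsetExpect_mono (hp0 : 0 ≤ p) (hp1 : p ≤ 1) (s : Finset α) {f g : Finset α → ℝ}
    (h : ∀ F ⊆ s, f F ≤ g F) : subsetExpect p s f ≤ subsetExpect p s g := by
  refine Finset.sum_le_sum fun F hF => mul_le_mul_of_nonneg_left (h F (Finset.mem_powerset.1 hF)) ?_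
  have : 0 ≤ 1 - p := by linarith
  positivity

lemma subsetExpect_add (s : Finset α) (f g : Finset α → ℝ) :
    subsetExpect p s (fun F => f F + g F) = subsetExpect p s f + subsetExpect p s g := by
  simp [subsetExpect, mul_add, Finset.sum_add_distrib]

lemma subsetExpect_sum {ι : Type*} (t : Finset ι) (s : Finset α) (f : ι → Finset α → ℝ) :
    subsetExpect p s (fun F => ∑ i ∈ t, f i F) = ∑ i ∈ t, subsetExpect p s (f i) := by
  simp only [subsetExpect, Finset.mul_sum]
  exact Finset.sum_comm

lemma subsetProb_nonneg (hp0 : 0 ≤ p) (hp1 : p ≤ 1) (s : Finset α) (A : Finset α → Prop) :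
    0 ≤ subsetProb p s A := by
  have := subsetExpect_mono hp0 hp1 s (f := fun _ => 0) (g := fun F => if A F then 1 else 0)
    (fun F _ => by positivity)
  simpa [subsetExpect, subsetProb] using this

lemma subsetProb_mono (hp0 : 0 ≤ p) (hp1 : p ≤ 1) (s : Finset α) {A B : Finset α → Prop}
    (h : ∀ F ⊆ s, A F → B F) : subsetProb p s A ≤ subsetProb p s B := by
  refine subsetExpect_mono hp0 hp1 s fun F hF => ?_
  have := h F hF
  by_cases hA : A F <;> by_cases hB : B F <;> simp_all

variable [DecidableEq α]

lemma subsetExpect_insert {s : Finset α} {e : α} (he : e ∉ s) (f : Finset α → ℝ) :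
    subsetExpect p (insert e s) f =
      (1 - p) * subsetExpect p s f + p * subsetExpect p s (fun F => f (insert e F)) := by
  unfold subsetExpect
  rw [Finset.sum_powerset_insert he, Finset.mul_sum, Finset.mul_sum]
  congr 1 <;> refine Finset.sum_congr rfl fun F hF => ?_
  · have hc := Finset.card_le_card (Finset.mem_powerset.1 hF)
    rw [Finset.card_insert_of_notMem he, Nat.sub_add_comm hc]
    ring
  · have heF : e ∉ F := fun h => he (Finset.mem_powerset.1 hF h)
    rw [Finset.card_insert_of_notMem he, Finset.card_insert_of_notMem heF, Nat.add_sub_add_right]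
    ring

lemma DisjOccur.mono {A A' B B' : Finset α → Prop} {F : Finset α} (h : DisjOccur A B F)
    (hA : ∀ K, A K → A' K) (hB : ∀ K, B K → B' K) : DisjOccur A' B' F := by
  obtain ⟨K, hK, h1, h2⟩ := h
  exact ⟨K, hK, hA _ h1, hB _ h2⟩

lemma monotone_disjOccur {A B : Finset α → Prop} (hB : Monotone B) : Monotone (DisjOccur A B) := by
  rintro F F' hF ⟨K, hK, h1, h2⟩
  exact ⟨K, hK.trans hF, h1, hB (Finset.sdiff_subset_sdiff hF subset_rfl) h2⟩

lemma DisjOccur.of_insert {A B : Finset α → Prop} {F : Finset α} {e : α} (he : e ∉ F)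
    (h : DisjOccur A B (insert e F)) :
    DisjOccur (fun K => A (insert e K)) B F ∨ DisjOccur A (fun K => B (insert e K)) F := by
  obtain ⟨K, hK, h1, h2⟩ := h
  by_cases heK : e ∈ K
  · refine Or.inl ⟨K.erase e, ?_, ?_, ?_⟩
    · intro x hx; have := hK (Finset.mem_of_mem_erase hx); grind
    · simpa [Finset.insert_erase heK] using h1
    · convert h2 using 1; ext x; grind
  · refine Or.inr ⟨K, ?_, h1, ?_⟩
    · intro x hx; have := hK hx; grind
    · convert h2 using 1; ext x; grind

/-- The van den Berg–Kesten inequality for increasing events. -/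
theorem subsetProb_disjOccur_le (hp0 : 0 ≤ p) (hp1 : p ≤ 1) (s : Finset α) :
    ∀ {A B : Finset α → Prop}, Monotone A → Monotone B →
      subsetProb p s (DisjOccur A B) ≤ subsetProb p s A * subsetProb p s B := by
  induction s using Finset.induction_on with
  | empty =>
    intro A B _ _
    by_cases hA : A ∅ <;> by_cases hB : B ∅ <;>
      simp [subsetProb, subsetExpect, DisjOccur, hA, hB]
  | insert e s he ih =>
    intro A B hA hB
    have hle : ∀ F : Finset α, F ≤ insert e F := fun F => Finset.subset_insert e F
    have hA1 : Monotone fun F => A (insert e F) :=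
      fun F F' h => hA (Finset.insert_subset_insert e h)
    have hB1 : Monotone fun F => B (insert e F) :=
      fun F F' h => hB (Finset.insert_subset_insert e h)
    have expand : ∀ C : Finset α → Prop, subsetProb p (insert e s) C =
        (1 - p) * subsetProb p s C + p * subsetProb p s (fun F => C (insert e F)) :=
      fun C => subsetExpect_insert he _
    rw [expand A, expand B, expand (DisjOccur A B)]
    have hm := ih hA hB
    have hu : subsetProb p s (fun F => DisjOccur A B (insert e F)) ≤
        subsetProb p s (fun F => A (insert e F)) * subsetProb p s (fun F => B (insert e F)) := by
      refine le_trans (subsetProb_mono hp0 hp1 s fun F hF h => ?_) (ih hA1 hB1)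
      rcases h.of_insert (fun h => he (hF h)) with h | h
      · exact h.mono (fun _ => id) fun K => hB (hle K)
      · exact h.mono (fun K => hA (hle K)) fun _ => id
    have hum : subsetProb p s (fun F => DisjOccur A B (insert e F)) +
          subsetProb p s (DisjOccur A B) ≤
        subsetProb p s (fun F => A (insert e F)) * subsetProb p s B +
          subsetProb p s A * subsetProb p s (fun F => B (insert e F)) := by
      refine le_trans ?_ (add_le_add (ih hA1 hB) (ih hA hB1))
      unfold subsetProb
      rw [← subsetExpect_add, ← subsetExpect_add]
      refine subsetExpect_mono hp0 hp1 s fun F hF => ?_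
      have h1 := DisjOccur.of_insert (A := A) (B := B) (fun h => he (hF h))
      have h2 : DisjOccur A B F → DisjOccur (fun K => A (insert e K)) B F :=
        fun h => h.mono (fun K => hA (hle K)) fun _ => id
      have h3 : DisjOccur A B F → DisjOccur A (fun K => B (insert e K)) F :=
        fun h => h.mono (fun _ => id) fun K => hB (hle K)
      by_cases c1 : DisjOccur A B F
      · simp only [c1, h2 c1, h3 c1, if_true]
        split_ifs <;> norm_num
      · by_cases c2 : DisjOccur A B (insert e F)
        · rcases h1 c2 with h | h <;> simp only [c1, c2, h, if_true, if_false] <;>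
            split_ifs <;> norm_num
        · simp only [c1, c2, if_false]
          split_ifs <;> norm_num
    have ha := subsetProb_mono hp0 hp1 s fun F _ => hA (hle F)
    have hb := subsetProb_mono hp0 hp1 s fun F _ => hB (hle F)
    generalize subsetProb p s (fun F => DisjOccur A B (insert e F)) = u at *
    generalize subsetProb p s (DisjOccur A B) = m at *
    generalize subsetProb p s (fun F => A (insert e F)) = a₁ at *
    generalize subsetProb p s (fun F => B (insert e F)) = b₁ at *
    generalize subsetProb p s A = a₀ at *
    generalize subsetProb p s B = b₀ at *
    have hab : 0 ≤ (a₁ - a₀) * (b₁ - b₀) := mul_nonneg (sub_nonneg.2 ha) (sub_nonneg.2 hb)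
    rcases le_total p (1 / 2) with h | h
    · have e1 := mul_le_mul_of_nonneg_left hum hp0
      have e2 := mul_le_mul_of_nonneg_left hm (by linarith : 0 ≤ 1 - 2 * p)
      have e3 := mul_nonneg (sq_nonneg p) hab
      linarith
    · have e1 := mul_le_mul_of_nonneg_left hum (by linarith : 0 ≤ 1 - p)
      have e2 := mul_le_mul_of_nonneg_left hu (by linarith : 0 ≤ 2 * p - 1)
      have e3 := mul_nonneg (sq_nonneg (1 - p)) hab
      linarith

end Subsets

/-- The vertices `x` and `y` are joined by a path with edges in `F`. -/
def EdgeConn {V : Type*} (x y : V) (F : Finset (Sym2 V)) : Prop :=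
  (SimpleGraph.fromEdgeSet (F : Set (Sym2 V))).Reachable x y

section EdgeConn

variable {V : Type*}

lemma monotone_edgeConn (x y : V) : Monotone (EdgeConn x y) :=
  fun _ _ h hF => hF.mono (SimpleGraph.fromEdgeSet_mono (Finset.coe_subset.2 h))

lemma edgeConn_comm {x y : V} : EdgeConn x y = EdgeConn y x := by
  ext F
  exact SimpleGraph.reachable_comm

lemma edgeConn_edges {F : Finset (Sym2 V)} {x y : V}
    (q : (SimpleGraph.fromEdgeSet (F : Set (Sym2 V))).Walk x y) {K : Finset (Sym2 V)}
    (hK : ∀ e ∈ q.edges, e ∈ K) : EdgeConn x y K := by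
  refine ⟨q.transfer _ fun e he => ?_⟩
  have := q.edges_subset_edgeSet he
  rw [SimpleGraph.edgeSet_fromEdgeSet] at this ⊢
  exact ⟨hK e he, this.2⟩

/-- A connection can be realised along a path, which can be cut at each of its vertices. -/
lemma EdgeConn.exists_path {F : Finset (Sym2 V)} {a b : V} (h : EdgeConn a b F) :
    ∃ K ⊆ F, EdgeConn a b K ∧ ∃ W : Set V, a ∈ W ∧ (∀ e ∈ K, ∀ v ∈ e, v ∈ W) ∧
      ∀ u ∈ W, DisjOccur (EdgeConn a u) (EdgeConn u b) K := by
  obtain ⟨q, hq⟩ := h.exists_isPath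
  refine ⟨q.edges.toFinset, fun e he => ?_, edgeConn_edges q fun e he => List.mem_toFinset.2 he,
    {v | v ∈ q.support}, q.start_mem_support, ?_, ?_⟩
  · have := q.edges_subset_edgeSet (List.mem_toFinset.1 he)
    rw [SimpleGraph.edgeSet_fromEdgeSet] at this
    exact this.1
  · intro e he v hv
    exact q.mem_support_of_mem_edges (List.mem_toFinset.1 he) hv
  · intro u hu
    have hsplit : q.edges = (q.takeUntil u hu).edges ++ (q.dropUntil u hu).edges := by
      rw [← SimpleGraph.Walk.edges_append, q.take_spec]
    have hnd := hq.isTrail.edges_nodup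
    rw [hsplit] at hnd ⊢
    have hdisj := List.disjoint_of_nodup_append hnd
    refine ⟨(q.takeUntil u hu).edges.toFinset, fun e he => ?_, ?_, ?_⟩
    · simp only [List.toFinset_append, Finset.mem_union]
      exact Or.inl he
    · exact edgeConn_edges _ fun e he => List.mem_toFinset.2 he
    · refine edgeConn_edges (q.dropUntil u hu) fun e he => ?_
      simp only [List.toFinset_append, Finset.mem_sdiff, Finset.mem_union, List.mem_toFinset]
      exact ⟨Or.inr he, fun h => hdisj h he⟩

/-- A vertex connected to the vertex set of `K` is connected to it without using `K`. -/
lemma EdgeConn.exists_first_hit {F K : Finset (Sym2 V)} {W : Set V}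
    (hKW : ∀ e ∈ K, ∀ v ∈ e, v ∈ W) {z x : V} (h : EdgeConn z x F) (hx : x ∈ W) :
    ∃ u ∈ W, EdgeConn z u (F \ K) := by
  obtain ⟨q⟩ := h
  induction q with
  | nil => exact ⟨_, hx, .refl _⟩
  | @cons a b c hab q ih =>
    by_cases ha : a ∈ W
    · exact ⟨a, ha, .refl _⟩
    · obtain ⟨u, hu, hbu⟩ := ih hx
      refine ⟨u, hu, SimpleGraph.Reachable.trans (SimpleGraph.Adj.reachable ?_) hbu⟩
      rw [SimpleGraph.fromEdgeSet_adj] at hab ⊢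
      refine ⟨?_, hab.2⟩
      rw [Finset.mem_coe, Finset.mem_sdiff]
      exact ⟨hab.1, fun h => ha (hKW _ h a (Sym2.mem_mk_left a b))⟩

lemma disjOccur_of_not_edgeConn {F : Finset (Sym2 V)} {x y z w : V} (hxy : EdgeConn x y F)
    (hzw : EdgeConn z w F) (hxz : ¬ EdgeConn x z F) :
    DisjOccur (EdgeConn x y) (EdgeConn z w) F := by
  obtain ⟨q⟩ := hxy
  obtain ⟨r⟩ := hzw
  refine ⟨q.edges.toFinset, fun e he => ?_, edgeConn_edges q fun e he => List.mem_toFinset.2 he,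
    edgeConn_edges r fun e he => ?_⟩
  · have := q.edges_subset_edgeSet (List.mem_toFinset.1 he)
    rw [SimpleGraph.edgeSet_fromEdgeSet] at this
    exact this.1
  · have hF := r.edges_subset_edgeSet he
    rw [SimpleGraph.edgeSet_fromEdgeSet] at hF
    refine Finset.mem_sdiff.2 ⟨hF.1, fun hq => hxz ?_⟩
    induction e using Sym2.ind with
    | _ a b =>
      have h1 := q.fst_mem_support_of_mem_edges (List.mem_toFinset.1 hq)
      have h2 := r.fst_mem_support_of_mem_edges he
      exact SimpleGraph.Reachable.trans ⟨q.takeUntil a h1⟩ ⟨(r.takeUntil a h2).reverse⟩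

/-- Edge-disjoint connections along the tree with inner vertices `u`, `v` and leaves
`a`, `b` at `v` and `c`, `d` at `u`. -/
def TreeConn (a b v u c d : V) : Finset (Sym2 V) → Prop :=
  DisjOccur (EdgeConn a v) (DisjOccur (EdgeConn v b) (DisjOccur (EdgeConn v u)
    (DisjOccur (EdgeConn u c) (EdgeConn u d))))

lemma treeConn_of_split {F K₁ K₂ K₃ K₄ : Finset (Sym2 V)} {a b v u c d : V}
    (hF₁ : K₁ ⊆ F) (hF₂ : K₂ ⊆ F) (hF₃ : K₃ ⊆ F) (hF₄ : K₄ ⊆ F)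
    (h₁ : DisjOccur (EdgeConn a v) (EdgeConn v u) K₁) (h₄ : EdgeConn v b K₄)
    (h₂ : EdgeConn u c K₂) (h₃ : EdgeConn u d K₃)
    (d₁₂ : Disjoint K₁ K₂) (d₁₃ : Disjoint K₁ K₃) (d₁₄ : Disjoint K₁ K₄)
    (d₂₃ : Disjoint K₂ K₃) (d₂₄ : Disjoint K₂ K₄) (d₃₄ : Disjoint K₃ K₄) :
    TreeConn a b v u c d F := by
  obtain ⟨M, hM, hav, hvu⟩ := h₁
  have s₁ : K₁ \ M ⊆ K₁ := Finset.sdiff_subset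
  refine ⟨M, hM.trans hF₁, hav, K₄, ?_, h₄, K₁ \ M, ?_, hvu, K₂, ?_, h₂,
    monotone_edgeConn _ _ ?_ h₃⟩ <;>
    simp only [Finset.subset_sdiff]
  · exact ⟨hF₄, (d₁₄.mono_left hM).symm⟩
  · exact ⟨⟨s₁.trans hF₁, Finset.sdiff_disjoint⟩, d₁₄.mono_left s₁⟩
  · exact ⟨⟨⟨hF₂, (d₁₂.mono_left hM).symm⟩, d₂₄⟩, (d₁₂.mono_left s₁).symm⟩
  · exact ⟨⟨⟨⟨hF₃, (d₁₃.mono_left hM).symm⟩, d₃₄⟩, (d₁₃.mono_left s₁).symm⟩, d₂₃.symm⟩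

/-- Four mutually connected vertices are the leaves of a trivalent tree of edge-disjoint
connections. -/
lemma exists_treeConn {F : Finset (Sym2 V)} {x y z w : V} (hxy : EdgeConn x y F)
    (hzx : EdgeConn z x F) (hwx : EdgeConn w x F) :
    ∃ u v, TreeConn x w v u y z F ∨ TreeConn y w v u x z F ∨ TreeConn z w v u x y F := by
  obtain ⟨K, hKF, -, W, hxW, hKW, hsplit⟩ := hxy.exists_path
  obtain ⟨u, hu, hzu⟩ := hzx.exists_first_hit hKW hxW
  obtain ⟨L, hLK, hxu, huy⟩ := hsplit u hu
  obtain ⟨K₁, hK₁, hc₁, W₁, hxW₁, hKW₁, hs₁⟩ := hxu.exists_path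
  obtain ⟨K₂, hK₂, hc₂, W₂, -, hKW₂, hs₂⟩ := (edgeConn_comm ▸ huy).exists_path
  obtain ⟨K₃, hK₃, hc₃, W₃, -, hKW₃, hs₃⟩ := hzu.exists_path
  have hKW' : ∀ e ∈ K₁ ∪ K₂ ∪ K₃, ∀ v ∈ e, v ∈ W₁ ∪ W₂ ∪ W₃ := by
    intro e he v hv
    rcases Finset.mem_union.1 he with he | he
    · rcases Finset.mem_union.1 he with he | he
      · exact Or.inl (Or.inl (hKW₁ e he v hv))
      · exact Or.inl (Or.inr (hKW₂ e he v hv))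
    · exact Or.inr (hKW₃ e he v hv)
  obtain ⟨v, hv, hwv⟩ := hwx.exists_first_hit hKW' (Or.inl (Or.inl hxW₁))
  have d12 : Disjoint K₁ K₂ := Finset.disjoint_sdiff.mono hK₁ hK₂
  have d13 : Disjoint K₁ K₃ := Finset.disjoint_sdiff.mono (hK₁.trans hLK) hK₃
  have d23 : Disjoint K₂ K₃ :=
    Finset.disjoint_sdiff.mono (hK₂.trans Finset.sdiff_subset) hK₃
  have f1 : K₁ ⊆ F := hK₁.trans (hLK.trans hKF)
  have f2 : K₂ ⊆ F := hK₂.trans (Finset.sdiff_subset.trans hKF)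
  have f3 : K₃ ⊆ F := hK₃.trans Finset.sdiff_subset
  have f4 : F \ (K₁ ∪ K₂ ∪ K₃) ⊆ F := Finset.sdiff_subset
  have d4 : Disjoint (K₁ ∪ K₂ ∪ K₃) (F \ (K₁ ∪ K₂ ∪ K₃)) := Finset.disjoint_sdiff
  rw [Finset.disjoint_union_left, Finset.disjoint_union_left] at d4
  obtain ⟨⟨d14, d24⟩, d34⟩ := d4
  rw [edgeConn_comm] at hwv
  refine ⟨u, v, ?_⟩
  rcases hv with (hv | hv) | hv
  · exact Or.inl (treeConn_of_split f1 f2 f3 f4 (hs₁ v hv) hwv (edgeConn_comm ▸ hc₂)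
      (edgeConn_comm ▸ hc₃) d12 d13 d14 d23 d24 d34)
  · exact Or.inr (Or.inl (treeConn_of_split f2 f1 f3 f4 (hs₂ v hv) hwv (edgeConn_comm ▸ hc₁)
      (edgeConn_comm ▸ hc₃) d12.symm d23 d24 d13 d14 d34))
  · exact Or.inr (Or.inr (treeConn_of_split f3 f1 f2 f4 (hs₃ v hv) hwv (edgeConn_comm ▸ hc₁)
      (edgeConn_comm ▸ hc₂) d13.symm d23.symm d34 d12 d14 d24))

end EdgeConn

section RandomGraph

variable {V : Type*} [Fintype V] {p : ℝ}

lemma percExpect_top (f : SimpleGraph V → ℝ) :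
    percExpect (⊤ : SimpleGraph V) p f =
      subsetExpect p (⊤ : SimpleGraph V).edgeFinset
        (fun F => f (SimpleGraph.fromEdgeSet (F : Set (Sym2 V)))) := by
  have hE : ∀ H : SimpleGraph V, Nat.card H.edgeSet = H.edgeFinset.card := fun H => by
    rw [Nat.card_eq_fintype_card, SimpleGraph.edgeFinset_card]
  unfold percExpect subsetExpect
  refine Finset.sum_bij' (fun H _ => H.edgeFinset)
    (fun F _ => SimpleGraph.fromEdgeSet (F : Set (Sym2 V))) ?_ ?_ ?_ ?_ ?_
  · intro H _
    exact Finset.mem_powerset.2 (SimpleGraph.edgeFinset_mono le_top)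
  · intro F _
    simp
  · intro H _
    simp
  · intro F hF
    rw [Finset.mem_powerset] at hF
    ext e
    have : e ∈ F → e ∈ (⊤ : SimpleGraph V).edgeSet := fun h => by simpa using hF h
    simp only [SimpleGraph.mem_edgeFinset, SimpleGraph.edgeSet_fromEdgeSet, Set.mem_sdiff,
      Finset.mem_coe]
    refine ⟨fun h => h.1, fun h => ⟨h, ?_⟩⟩
    simpa using this h
  · intro H _
    rw [hE, hE]
    dsimp only
    rw [SimpleGraph.coe_edgeFinset, SimpleGraph.fromEdgeSet_edgeSet]
    congr!

lemma sumPow_two (H : SimpleGraph V) :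
    sumPow H 2 = ∑ x, ∑ y, if H.Reachable x y then 1 else 0 := by
  have hc : ∀ c : H.ConnectedComponent, (Nat.card c.supp : ℝ) =
      ∑ x, if H.connectedComponentMk x = c then 1 else 0 := by
    intro c
    rw [Finset.sum_boole, Nat.card_eq_fintype_card, Fintype.card_subtype]
    simp only [SimpleGraph.ConnectedComponent.mem_supp_iff]
  simp only [sumPow, hc, sq, Finset.sum_mul_sum]
  rw [Finset.sum_comm]
  refine Finset.sum_congr rfl fun x _ => ?_
  rw [Finset.sum_comm]
  refine Finset.sum_congr rfl fun y _ => ?_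
  simp [← SimpleGraph.ConnectedComponent.eq, eq_comm]

/-- Probability that `x` and `y` are connected in the random graph on `V` with edge
probability `p`. -/
def connProb (p : ℝ) (x y : V) : ℝ :=
  subsetProb p (⊤ : SimpleGraph V).edgeFinset (EdgeConn x y)

lemma connProb_comm (x y : V) : connProb p x y = connProb p y x := by
  rw [connProb, edgeConn_comm, connProb]

lemma connProb_perm (σ : Equiv.Perm V) (x y : V) :
    connProb p (σ x) (σ y) = connProb p x y := by
  have h : ∀ x y : V, connProb p x y =
      percExpect (⊤ : SimpleGraph V) p (fun H => if H.Reachable x y then 1 else 0) := fun x y => by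
    rw [percExpect_top]
    unfold connProb subsetProb EdgeConn
    congr!
  rw [h, h]
  unfold percExpect
  simp only [le_top, Finset.filter_true]
  refine Fintype.sum_equiv σ.symm.simpleGraph _ _ fun H => ?_
  have i : H.comap σ ≃g H := SimpleGraph.Iso.comap σ H
  have hr : (H.comap σ).Reachable x y ↔ H.Reachable (σ x) (σ y) :=
    ((SimpleGraph.Iso.comap σ H).reachable_iff).symm
  have he : Nat.card (H.comap σ).edgeSet = Nat.card H.edgeSet := Nat.card_congr i.mapEdgeSet
  change _ = p ^ Nat.card (H.comap σ).edgeSet * (1 - p) ^ (_ - Nat.card (H.comap σ).edgeSet) *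
    (if (H.comap σ).Reachable x y then 1 else 0)
  simp only [hr, he]

lemma sum_connProb_eq (x x' : V) : ∑ y, connProb p x y = ∑ y, connProb p x' y := by
  have h := connProb_perm (p := p) (Equiv.swap x x') x
  rw [Equiv.swap_apply_left] at h
  simp only [← h]
  exact Equiv.sum_comp (Equiv.swap x x') (connProb p x')

lemma subsetProb_treeConn_le (hp0 : 0 ≤ p) (hp1 : p ≤ 1) (a b v u c d : V) :
    subsetProb p (⊤ : SimpleGraph V).edgeFinset (TreeConn a b v u c d) ≤
      connProb p a v * (connProb p v b * (connProb p v u *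
        (connProb p u c * connProb p u d))) := by
  have hn : ∀ x y : V, 0 ≤ connProb p x y := fun x y => subsetProb_nonneg hp0 hp1 _ _
  have step : ∀ (x y : V) {B : Finset (Sym2 V) → Prop} {r : ℝ}, Monotone B →
      subsetProb p (⊤ : SimpleGraph V).edgeFinset B ≤ r →
      subsetProb p (⊤ : SimpleGraph V).edgeFinset (DisjOccur (EdgeConn x y) B) ≤
        connProb p x y * r := fun x y _ _ hB hr =>
    (subsetProb_disjOccur_le hp0 hp1 _ (monotone_edgeConn x y) hB).trans
      (mul_le_mul_of_nonneg_left hr (hn x y))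
  have m₁ := monotone_edgeConn u d
  have m₂ := monotone_disjOccur (A := EdgeConn u c) m₁
  have m₃ := monotone_disjOccur (A := EdgeConn v u) m₂
  have m₄ := monotone_disjOccur (A := EdgeConn v b) m₃
  exact step a v m₄ (step v b m₃ (step v u m₂ (step u c m₁ le_rfl)))

/-- Two connections occur only if they occur disjointly or all four endpoints are leaves of a
tree of edge-disjoint connections. -/
lemma edgeConn_mul_edgeConn_le (x y z w : V) (F : Finset (Sym2 V)) :
    ((if EdgeConn x y F then 1 else 0) * (if EdgeConn z w F then 1 else 0) : ℝ) ≤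
      (if DisjOccur (EdgeConn x y) (EdgeConn z w) F then 1 else 0) +
      ∑ u, ∑ v, ((if TreeConn x w v u y z F then 1 else 0) +
        ((if TreeConn y w v u x z F then 1 else 0) +
          (if TreeConn z w v u x y F then 1 else 0))) := by
  have hpos : ∀ P : Prop, (0 : ℝ) ≤ if P then 1 else 0 := fun P => by split_ifs <;> norm_num
  have hpos' : ∀ u v, (0 : ℝ) ≤ (if TreeConn x w v u y z F then 1 else 0) +
        ((if TreeConn y w v u x z F then 1 else 0) +
          (if TreeConn z w v u x y F then 1 else 0)) := fun u v =>
    add_nonneg (hpos _) (add_nonneg (hpos _) (hpos _))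
  have hsum := Finset.sum_nonneg fun u (_ : u ∈ Finset.univ) =>
    Finset.sum_nonneg fun v (_ : v ∈ Finset.univ) => hpos' u v
  by_cases h : EdgeConn x y F ∧ EdgeConn z w F
  swap
  · refine le_trans (le_of_eq ?_) (add_nonneg (hpos _) hsum)
    rw [not_and_or] at h
    rcases h with h | h <;> simp [h]
  obtain ⟨hxy, hzw⟩ := h
  rw [if_pos hxy, if_pos hzw, mul_one]
  by_cases hxz : EdgeConn x z F
  · have hzx : EdgeConn z x F := SimpleGraph.Reachable.symm hxz
    have hwx : EdgeConn w x F := SimpleGraph.Reachable.trans (SimpleGraph.Reachable.symm hzw) hzx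
    obtain ⟨u, v, huv⟩ := exists_treeConn hxy hzx hwx
    refine le_add_of_nonneg_of_le (hpos _) ?_
    refine le_trans ?_ (Finset.single_le_sum (fun u _ => Finset.sum_nonneg fun v _ => hpos' u v)
      (Finset.mem_univ u))
    refine le_trans ?_ (Finset.single_le_sum (fun v _ => hpos' u v) (Finset.mem_univ v))
    have h₁ := hpos (TreeConn x w v u y z F)
    have h₂ := hpos (TreeConn y w v u x z F)
    have h₃ := hpos (TreeConn z w v u x y F)
    rcases huv with h | h | h
    · rw [if_pos h]; linarith
    · rw [if_pos h]; linarith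
    · rw [if_pos h]; linarith
  · rw [if_pos (disjOccur_of_not_edgeConn hxy hzw hxz)]
    linarith

lemma sum_fifth_comm {V M : Type*} [Fintype V] [AddCommMonoid M] (f : V → V → V → V → V → M) :
    ∑ x, ∑ y, ∑ z, ∑ w, ∑ u, f x y z w u = ∑ u, ∑ x, ∑ y, ∑ z, ∑ w, f x y z w u :=
  (Finset.sum_congr rfl fun _ _ => (Finset.sum_congr rfl fun _ _ => (Finset.sum_congr rfl
    fun _ _ => Finset.sum_comm).trans Finset.sum_comm).trans Finset.sum_comm).trans Finset.sum_comm

lemma sum_tree_connProb {χ : ℝ} (hχ : ∀ x : V, ∑ y, connProb p x y = χ) :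
    ∑ x : V, ∑ y : V, ∑ z : V, ∑ w : V, ∑ u : V, ∑ v : V,
      (connProb p x v * (connProb p v w * (connProb p v u * (connProb p u y * connProb p u z))) +
      (connProb p y v * (connProb p v w * (connProb p v u * (connProb p u x * connProb p u z))) +
      connProb p z v * (connProb p v w * (connProb p v u * (connProb p u x * connProb p u y))))) =
      3 * Fintype.card V * χ ^ 5 := by
  have hχ' : ∀ x : V, ∑ y, connProb p y x = χ := fun x => by
    simp only [connProb_comm _ x, hχ]
  rw [sum_fifth_comm]
  rw [Finset.sum_congr rfl fun u _ => sum_fifth_comm _]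
  simp only [Finset.sum_add_distrib, ← Finset.mul_sum, ← Finset.sum_mul, hχ, hχ']
  simp
  ring

/-- Bound on `E[(∑_i |C_i|^2)^2]` for the random graph on `V` in terms of `E[∑_i |C_i|^2]`. -/
theorem percExpect_sumPow_sq_le [Nonempty V] (hp0 : 0 ≤ p) (hp1 : p ≤ 1) :
    percExpect (⊤ : SimpleGraph V) p (fun H => sumPow H 2 * sumPow H 2) ≤
      (percExpect (⊤ : SimpleGraph V) p (fun H => sumPow H 2) +
        3 * (percExpect (⊤ : SimpleGraph V) p (fun H => sumPow H 2) / Fintype.card V) ^ 4) *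
      percExpect (⊤ : SimpleGraph V) p (fun H => sumPow H 2) := by
  have hpow : ∀ F : Finset (Sym2 V),
      sumPow (SimpleGraph.fromEdgeSet (F : Set (Sym2 V))) 2 =
        ∑ x, ∑ y, if EdgeConn x y F then 1 else 0 := fun F => by
    rw [sumPow_two]
    unfold EdgeConn
    congr!
  obtain ⟨χ, hχ⟩ : ∃ χ, ∀ x : V, ∑ y, connProb p x y = χ :=
    ⟨_, fun x => sum_connProb_eq x (Classical.arbitrary V)⟩
  have hS : percExpect (⊤ : SimpleGraph V) p (fun H => sumPow H 2) = Fintype.card V * χ := by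
    simp only [percExpect_top, hpow, subsetExpect_sum]
    change ∑ x : V, ∑ y, connProb p x y = Fintype.card V * χ
    simp [hχ]
  have hV : (Fintype.card V : ℝ) ≠ 0 := by simp
  have hrhs : (Fintype.card V * χ + 3 * (Fintype.card V * χ / Fintype.card V) ^ 4) *
      (Fintype.card V * χ) = (Fintype.card V * χ) ^ 2 + 3 * Fintype.card V * χ ^ 5 := by
    field_simp
  have hpairs : ∑ x : V, ∑ y, ∑ z : V, ∑ w, connProb p x y * connProb p z w =
      (Fintype.card V * χ) ^ 2 := by
    simp only [← Finset.mul_sum, ← Finset.sum_mul, hχ]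
    simp
    ring
  rw [hS, hrhs, ← hpairs, ← sum_tree_connProb hχ, percExpect_top]
  simp only [hpow, Finset.sum_mul]
  simp only [Finset.mul_sum, subsetExpect_sum, ← Finset.sum_add_distrib]
  refine Finset.sum_le_sum fun x _ => Finset.sum_le_sum fun y _ => Finset.sum_le_sum fun z _ =>
    Finset.sum_le_sum fun w _ => ?_
  refine (subsetExpect_mono hp0 hp1 _ fun F _ => edgeConn_mul_edgeConn_le x y z w F).trans ?_
  simp only [subsetExpect_add, subsetExpect_sum, Finset.sum_add_distrib]
  gcongr
  · exact subsetProb_disjOccur_le hp0 hp1 _ (monotone_edgeConn x y) (monotone_edgeConn z w)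
  all_goals exact subsetProb_treeConn_le hp0 hp1 ..

end RandomGraph

/-- For `G(n,p)`:
`E[∑_{i,j} |C_i|^2 |C_j|^2] ≤ (S_n(p) + 3 (S_n(p)/n)^4) · S_n(p)`,
where the sum is over all ordered pairs of components (including `i = j`). -/
theorem all_pairs_bound (n : ℕ) (hn : 1 ≤ n) (p : ℝ) (hp0 : 0 ≤ p) (hp1 : p ≤ 1) :
    percExpect (⊤ : SimpleGraph (Fin n)) p
        (fun H => ∑ c : H.ConnectedComponent, ∑ c' : H.ConnectedComponent,
          (Nat.card c.supp : ℝ) ^ 2 * (Nat.card c'.supp : ℝ) ^ 2)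
      ≤ (S n p + 3 * (S n p / n) ^ 4) * S n p := by
  have : Nonempty (Fin n) := ⟨⟨0, hn⟩⟩
  have h := percExpect_sumPow_sq_le (V := Fin n) hp0 hp1
  rw [Fintype.card_fin] at h
  refine le_of_eq_of_le ?_ h
  congr 1
  funext H
  rw [← Finset.sum_mul_sum]
  unfold sumPow
  congr!
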